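/- arXiv:1912.01462 — 2 statements merged into one kernel-verified Lean document; each statement's English description precedes it below -/
import Mathlib

section
/- Let n be a positive integer, let E⁺, E⁻ be invertible n×n complex matrices such that X := E⁺ − E⁻ * (E⁺)⁻¹ * E⁻ and Y := E⁻ − E⁺ * (E⁻)⁻¹ * E⁺ are invertible, and let d : Fin n → ℝ with d i > 0 for all i. For t ∈ ℝ let Δ(t) denote the n×n complex diagonal matrix with diagonal entries exp(t·d i), and define Φ⁺⁻(t) := E⁻ * Δ(t) * X⁻¹ + E⁺ * Δ(−t) * Y⁻¹ and Φ⁻⁻(t) := E⁻ * Δ(t) * Y⁻¹ + E⁺ * Δ(−t) * X⁻¹. Then the function t ↦ −(Φ⁻⁻(t))⁻¹ * Φ⁺⁻(t) tends to E⁺ * (E⁻)⁻¹ as t → ∞ (convergence of matrices, e.g. entrywise). -/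
open Filter

/-- Damping a fixed matrix by decaying exponentials on both sides sends it to zero. -/
theorem tendsto_diagonal_exp_neg_mul_mul {ι : Type*} [Fintype ι] [DecidableEq ι]
    (d : ι → ℝ) (hd : ∀ i, 0 < d i) (K L : Matrix ι ι ℂ) :
    Tendsto (fun t : ℝ =>
      Matrix.diagonal (fun i => Complex.exp (-t * d i)) * K
        * Matrix.diagonal (fun i => Complex.exp (-t * d i)) * L) atTop (nhds 0) := by
  have hD : Tendsto (fun t : ℝ => Matrix.diagonal (fun i => Complex.exp (-t * d i)))
      atTop (nhds 0) := by
    rw [← Matrix.diagonal_zero]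
    refine (Continuous.matrix_diagonal continuous_id).tendsto _ |>.comp
      (tendsto_pi_nhds.2 fun i => ?_)
    rw [Complex.tendsto_exp_nhds_zero_iff]
    have h : Tendsto (fun t : ℝ => -(t * d i)) atTop atBot :=
      tendsto_neg_atTop_atBot.comp (tendsto_id.atTop_mul_const (hd i))
    simpa using h
  simpa using ((hD.mul_const K).mul hD).mul_const L

/-- If `F` tends to zero, then the nonsingular inverse of `1 + F` tends to the identity matrix. -/
theorem tendsto_one_add_inv_of_tendsto_zero {α ι : Type*} [Fintype ι] [DecidableEq ι]
    {l : Filter α} {F : α → Matrix ι ι ℂ} (hF : Tendsto F l (nhds 0)) :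
    Tendsto (fun a => (1 + F a)⁻¹) l (nhds 1) := by
  have h : Tendsto (fun a => 1 + F a) l (nhds 1) := by simpa using hF.const_add 1
  have hinv : ContinuousAt Ring.inverse (1 : Matrix ι ι ℂ).det := by
    rw [Ring.inverse_eq_inv', Matrix.det_one]
    exact continuousAt_inv₀ one_ne_zero
  simpa [Function.comp_def] using (continuousAt_matrix_inv 1 hinv).tendsto.comp h

/-- Factoring the growing exponential out of a block of the state-transition matrix. -/
theorem mul_mul_inv_add_eq_mul_one_add_mul {ι : Type*} [Fintype ι] [DecidableEq ι]
    {A B D D' U V : Matrix ι ι ℂ} (hA : IsUnit A) (hU : IsUnit U) (hD : D * D' = 1) :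
    A * D * U⁻¹ + B * D' * V⁻¹
      = A * D * (1 + D' * (A⁻¹ * B) * D' * (V⁻¹ * U)) * U⁻¹ := by
  have hA' : A * A⁻¹ = 1 := Matrix.mul_nonsing_inv A ((Matrix.isUnit_iff_isUnit_det A).1 hA)
  have hU' : U * U⁻¹ = 1 := Matrix.mul_nonsing_inv U ((Matrix.isUnit_iff_isUnit_det U).1 hU)
  have h : A * D * (D' * (A⁻¹ * B) * D' * (V⁻¹ * U)) * U⁻¹
      = A * (D * D') * A⁻¹ * B * D' * V⁻¹ * (U * U⁻¹) := by
    simp only [Matrix.mul_assoc]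
  rw [Matrix.mul_add, Matrix.add_mul, h, hD, hU', Matrix.mul_one, Matrix.mul_one, Matrix.mul_one,
    hA', Matrix.one_mul]

/-- The vector bidirectional reflectance of an infinitely deep homogeneous water body:
the reflectance `−(Φ⁻⁻(t))⁻¹ Φ⁺⁻(t)` of the layer of thickness `t` converges, as
`t → ∞`, to `E⁺(E⁻)⁻¹`. -/
theorem deep_water_reflectance_limit (n : ℕ) (hn : 0 < n)
    (Ep Em : Matrix (Fin n) (Fin n) ℂ) (hEp : IsUnit Ep) (hEm : IsUnit Em)
    (hX : IsUnit (Ep - Em * Ep⁻¹ * Em)) (hY : IsUnit (Em - Ep * Em⁻¹ * Ep))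
    (d : Fin n → ℝ) (hd : ∀ i, 0 < d i) :
    Tendsto
      (fun t : ℝ =>
        -(Em * Matrix.diagonal (fun i => Complex.exp (t * d i)) * (Em - Ep * Em⁻¹ * Ep)⁻¹
            + Ep * Matrix.diagonal (fun i => Complex.exp (-t * d i)) * (Ep - Em * Ep⁻¹ * Em)⁻¹)⁻¹
          * (Em * Matrix.diagonal (fun i => Complex.exp (t * d i)) * (Ep - Em * Ep⁻¹ * Em)⁻¹
            + Ep * Matrix.diagonal (fun i => Complex.exp (-t * d i)) * (Em - Ep * Em⁻¹ * Ep)⁻¹))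
      atTop (nhds (Ep * Em⁻¹)) := by
  have hEp' : Ep * Ep⁻¹ = 1 := Matrix.mul_nonsing_inv Ep ((Matrix.isUnit_iff_isUnit_det Ep).1 hEp)
  have hEm' : Em⁻¹ * Em = 1 := Matrix.nonsing_inv_mul Em ((Matrix.isUnit_iff_isUnit_det Em).1 hEm)
  have hXY : Em - Ep * Em⁻¹ * Ep = -(Ep * Em⁻¹ * (Ep - Em * Ep⁻¹ * Em)) := by
    have h : Ep * Em⁻¹ * (Em * Ep⁻¹ * Em) = Ep * (Em⁻¹ * Em) * Ep⁻¹ * Em := by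
      simp only [Matrix.mul_assoc]
    rw [Matrix.mul_sub, h, hEm', Matrix.mul_one, hEp', Matrix.one_mul, neg_sub]
  generalize Ep - Em * Ep⁻¹ * Em = X at *
  generalize Em - Ep * Em⁻¹ * Ep = Y at *
  have hX' : X * X⁻¹ = 1 := Matrix.mul_nonsing_inv X ((Matrix.isUnit_iff_isUnit_det X).1 hX)
  have hlim : Ep * Em⁻¹ = -(Y * 1 * (1 + 0) * X⁻¹) := by
    rw [hXY, add_zero, Matrix.mul_one, Matrix.mul_one, Matrix.neg_mul, neg_neg, Matrix.mul_assoc,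
      hX', Matrix.mul_one]
  rw [hlim]
  have hF := tendsto_diagonal_exp_neg_mul_mul d hd (Em⁻¹ * Ep) (X⁻¹ * Y)
  have hG := tendsto_diagonal_exp_neg_mul_mul d hd (Em⁻¹ * Ep) (Y⁻¹ * X)
  refine ((((tendsto_one_add_inv_of_tendsto_zero hF).const_mul Y).mul
    (hG.const_add 1)).mul_const X⁻¹).neg.congr fun t => ?_
  have hD : Matrix.diagonal (fun i => Complex.exp (t * d i))
      * Matrix.diagonal (fun i => Complex.exp (-t * d i)) = 1 := by
    simp [Matrix.diagonal_mul_diagonal, ← Complex.exp_add]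
  rw [mul_mul_inv_add_eq_mul_one_add_mul hEm hY hD, mul_mul_inv_add_eq_mul_one_add_mul hEm hX hD]
  have hED : IsUnit (Em * Matrix.diagonal (fun i => Complex.exp (t * d i))).det :=
    (Matrix.isUnit_iff_isUnit_det _).1 (hEm.mul (IsUnit.of_mul_eq_one _ hD))
  rw [Matrix.mul_inv_rev, Matrix.mul_inv_rev,
    Matrix.nonsing_inv_nonsing_inv _ ((Matrix.isUnit_iff_isUnit_det Y).1 hY), Matrix.neg_mul]
  congr 1
  simp only [Matrix.mul_assoc _ _ X⁻¹]
  rw [Matrix.mul_assoc Y, Matrix.mul_assoc Y, Matrix.mul_assoc (_⁻¹),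
    Matrix.nonsing_inv_mul_cancel_left _ _ hED]
end

section
/- Let n be a positive integer, let E⁺, E⁻ be invertible n×n complex matrices such that X := E⁺ − E⁻ * (E⁺)⁻¹ * E⁻ and Y := E⁻ − E⁺ * (E⁻)⁻¹ * E⁺ are invertible, and let d : Fin n → ℝ. For t ∈ ℝ let Δ(t) denote the n×n complex diagonal matrix with diagonal entries exp(t·d i). Let s⁺ : Fin n → ℂ and set s⁻ := (E⁺ * (E⁻)⁻¹).mulVec s⁺ and I⁻ := Y⁻¹.mulVec s⁺ + X⁻¹.mulVec s⁻. Define u(t) := (E⁺ * Δ(t) * X⁻¹ + E⁻ * Δ(−t) * Y⁻¹).mulVec s⁺ + (E⁺ * Δ(t) * Y⁻¹ + E⁻ * Δ(−t) * X⁻¹).mulVec s⁻ and w(t) := (E⁻ * Δ(t) * X⁻¹ + E⁺ * Δ(−t) * Y⁻¹).mulVec s⁺ + (E⁻ * Δ(t) * Y⁻¹ + E⁺ * Δ(−t) * X⁻¹).mulVec s⁻. Then for every t ∈ ℝ: u(t) = (E⁻ * Δ(−t)).mulVec I⁻ and w(t) = (E⁺ * Δ(−t)).mulVec I⁻; moreover,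 if d i > 0 for all i, then u(t) → 0 and w(t) → 0 as t → ∞. -/
open Filter

namespace Matrix

variable {ι R : Type*} [Fintype ι] [CommRing R]

/-- The two Schur complements of the block matrix `[[A, B], [B, A]]` are related by
`(B - A B⁻¹ A)⁻¹ A B⁻¹ = -(A - B A⁻¹ B)⁻¹`. -/
lemma inv_schur_mul_mul_inv [DecidableEq ι] (A B : Matrix ι ι R) (hA : IsUnit A) (hB : IsUnit B)
    (hX : IsUnit (A - B * A⁻¹ * B)) (hY : IsUnit (B - A * B⁻¹ * A)) :
    (B - A * B⁻¹ * A)⁻¹ * (A * B⁻¹) = -(A - B * A⁻¹ * B)⁻¹ := by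
  rw [isUnit_iff_isUnit_det] at hA hB hX hY
  have key : A * B⁻¹ * (A - B * A⁻¹ * B) = -(B - A * B⁻¹ * A) := by
    have h : A * B⁻¹ * (B * A⁻¹ * B) = B := by
      rw [mul_assoc B, mul_assoc A, nonsing_inv_mul_cancel_left _ _ hB,
        mul_nonsing_inv_cancel_left _ _ hA]
    rw [mul_sub, h, neg_sub]
  rw [← mul_nonsing_inv_cancel_right (A - B * A⁻¹ * B) (_ * (A * B⁻¹)) hX,
    mul_assoc _ (A * B⁻¹), key, mul_neg, nonsing_inv_mul _ hY, neg_one_mul]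

/-- If `P s + Q r = 0`, only the second mode of a two-mode propagator survives. -/
lemma propagator_mulVec_of_mode_eq_zero (A B D D' P Q : Matrix ι ι R) (s r : ι → R)
    (h : P *ᵥ s + Q *ᵥ r = 0) :
    (A * D * P + B * D' * Q) *ᵥ s + (A * D * Q + B * D' * P) *ᵥ r =
      (B * D') *ᵥ (Q *ᵥ s + P *ᵥ r) := by
  have h' : (A * D) *ᵥ (P *ᵥ s) + (A * D) *ᵥ (Q *ᵥ r) = 0 := by
    rw [← mulVec_add, h, mulVec_zero]
  simp only [add_mulVec, ← mulVec_mulVec, mulVec_add] at h' ⊢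
  rw [add_add_add_comm, h', zero_add]

/-- A diagonal propagator with strictly negative rates sends every vector to `0`. -/
lemma tendsto_mul_diagonal_exp_neg_mulVec [DecidableEq ι] (A : Matrix ι ι ℂ) (d : ι → ℝ)
    (hd : ∀ i, 0 < d i) (v : ι → ℂ) :
    Tendsto (fun t : ℝ => (A * diagonal fun i => Complex.exp ((-t : ℝ) * d i)) *ᵥ v)
      atTop (nhds 0) := by
  have hdiag : Tendsto (fun t : ℝ => (diagonal fun i => Complex.exp ((-t : ℝ) * d i)) *ᵥ v)
      atTop (nhds 0) := by
    refine tendsto_pi_nhds.2 fun i => ?_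
    have hexp : Tendsto (fun t : ℝ => Complex.exp ((-t : ℝ) * d i)) atTop (nhds 0) := by
      refine Complex.tendsto_exp_nhds_zero_iff.2 ?_
      simpa using tendsto_id.atTop_mul_const (hd i)
    simpa only [mulVec_diagonal, zero_mul, Pi.zero_apply] using hexp.mul_const (v i)
  have hA : Continuous fun x : ι → ℂ => A *ᵥ x := by fun_prop
  simpa only [Function.comp_def, mulVec_mulVec, mulVec_zero] using (hA.tendsto 0).comp hdiag

end Matrix

/-- The asymptotic radiance distribution: under the deep-water boundary condition
`s⁻ = E⁺(E⁻)⁻¹ s⁺`, the downwelling and upwelling components `u(t)`, `w(t)` of the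
propagated Stokes-vector transform satisfy `u(t) = E⁻ Δ(−t) I⁻` and `w(t) = E⁺ Δ(−t) I⁻`,
and decay to `0` as `t → ∞` when all eigenvalues `d i` are positive. -/
theorem asymptotic_radiance_distribution (n : ℕ) (hn : 0 < n)
    (Ep Em : Matrix (Fin n) (Fin n) ℂ) (hEp : IsUnit Ep) (hEm : IsUnit Em)
    (hX : IsUnit (Ep - Em * Ep⁻¹ * Em)) (hY : IsUnit (Em - Ep * Em⁻¹ * Ep))
    (d : Fin n → ℝ)
    (Δ : ℝ → Matrix (Fin n) (Fin n) ℂ)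
    (hΔ : ∀ t : ℝ, Δ t = Matrix.diagonal (fun i => Complex.exp (t * d i)))
    (sp sm Im : Fin n → ℂ)
    (hsm : sm = (Ep * Em⁻¹).mulVec sp)
    (hIm : Im = ((Em - Ep * Em⁻¹ * Ep)⁻¹).mulVec sp + ((Ep - Em * Ep⁻¹ * Em)⁻¹).mulVec sm)
    (u w : ℝ → Fin n → ℂ)
    (hu : ∀ t : ℝ, u t =
      (Ep * Δ t * (Ep - Em * Ep⁻¹ * Em)⁻¹ + Em * Δ (-t) * (Em - Ep * Em⁻¹ * Ep)⁻¹).mulVec sp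
        + (Ep * Δ t * (Em - Ep * Em⁻¹ * Ep)⁻¹ + Em * Δ (-t) * (Ep - Em * Ep⁻¹ * Em)⁻¹).mulVec sm)
    (hw : ∀ t : ℝ, w t =
      (Em * Δ t * (Ep - Em * Ep⁻¹ * Em)⁻¹ + Ep * Δ (-t) * (Em - Ep * Em⁻¹ * Ep)⁻¹).mulVec sp
        + (Em * Δ t * (Em - Ep * Em⁻¹ * Ep)⁻¹ + Ep * Δ (-t) * (Ep - Em * Ep⁻¹ * Em)⁻¹).mulVec sm) :
    (∀ t : ℝ, u t = (Em * Δ (-t)).mulVec Im ∧ w t = (Ep * Δ (-t)).mulVec Im) ∧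
    ((∀ i, 0 < d i) →
      Tendsto u atTop (nhds 0) ∧ Tendsto w atTop (nhds 0)) := by
  have hmode : (Ep - Em * Ep⁻¹ * Em)⁻¹.mulVec sp + (Em - Ep * Em⁻¹ * Ep)⁻¹.mulVec sm = 0 := by
    rw [hsm, Matrix.mulVec_mulVec, Matrix.inv_schur_mul_mul_inv Ep Em hEp hEm hX hY,
      Matrix.neg_mulVec, add_neg_cancel]
  have hu' (t : ℝ) : u t = (Em * Δ (-t)).mulVec Im := by
    rw [hu, hIm, Matrix.propagator_mulVec_of_mode_eq_zero _ _ _ _ _ _ _ _ hmode]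
  have hw' (t : ℝ) : w t = (Ep * Δ (-t)).mulVec Im := by
    rw [hw, hIm, Matrix.propagator_mulVec_of_mode_eq_zero _ _ _ _ _ _ _ _ hmode]
  refine ⟨fun t => ⟨hu' t, hw' t⟩, fun hd => ⟨?_, ?_⟩⟩
  · simpa only [funext hu', hΔ] using Matrix.tendsto_mul_diagonal_exp_neg_mulVec Em d hd Im
  · simpa only [funext hw', hΔ] using Matrix.tendsto_mul_diagonal_exp_neg_mulVec Ep d hd Im
end
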